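/- Let k ≥ 1 be an integer, α, β ∈ ℝ∖ℤ, and x ∈ ℂ with Re(x) > 0 (so also Re(1/x) > 0). Then 𝓕_k(x; α, β) + (−x)^{k−2} · 𝓕_k(1/x; β, α) = (1/x) · Li_k(e^{2πiα}) − (−x)^{k−1} · Li_k(e^{2πiβ}) + Σ_{r=1}^{k−1} (−x)^{r−1} · Li_{k−r}(e^{2πiα}) · Li_r(e^{2πiβ}), where (−x)^{k−2} is the integer power (equal to (−x)^{−1} = −1/x when k = 1) and the sum over r is empty when k = 1. -/

import Mathlib

open Complex MeasureTheory Filter Topology Set Asymptotics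

noncomputable section

/-- `e2pi θ = e^{2πiθ}`. -/
def e2pi (θ : ℝ) : ℂ := Complex.exp (2 * Real.pi * Complex.I * θ)

/-- Polylogarithm of integer order: `Li 0 z = z/(1-z)`, `Li 1 z = -Log(1-z)`,
`Li m z = ∑_{n≥1} z^n/n^m` for `m ≥ 2`. -/
def Li : ℕ → ℂ → ℂ
  | 0, z => z / (1 - z)
  | 1, z => -Complex.log (1 - z)
  | (m+2), z => ∑' n : ℕ, z ^ (n+1) / ((n+1 : ℕ) : ℂ) ^ (m+2)

/-- The higher Herglotz–Zagier–Novikov function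
`𝓕_k(x; α, β) = ∫₀^∞ Li_{k-1}(e^{-xt} e^{2πiα}) / (1 - e^{-t} e^{2πiβ}) dt`. -/
def HHZN (k : ℕ) (x : ℂ) (α β : ℝ) : ℂ :=
  ∫ t in Set.Ioi (0:ℝ),
    Li (k-1) (Complex.exp (-x * t) * e2pi α) / (1 - Complex.exp (-(t:ℂ)) * e2pi β)

theorem Li_eq_tsum (m : ℕ) {w : ℂ} (hw : ‖w‖ < 1) :
    Li m w = ∑' n : ℕ, w ^ (n+1) / ((n+1 : ℕ) : ℂ) ^ m := by
  match m with
  | 0 =>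
    simp only [Li, pow_zero, div_one, pow_succ]
    rw [tsum_mul_right, tsum_geometric_of_norm_lt_one hw]
    field_simp
  | 1 =>
    simp only [Li, pow_one]
    have := (hasSum_taylorSeries_neg_log' hw).tsum_eq
    rw [← this]
    push_cast
    rfl
  | (m+2) => rfl

theorem Li_hasDerivAt (m : ℕ) {w : ℂ} (hw : ‖w‖ < 1) (hw0 : w ≠ 0) :
    HasDerivAt (Li (m+1)) (Li m w / w) w := by
  obtain ⟨r, hr1, hr2⟩ := exists_between hw
  have hr0 : 0 ≤ r := (norm_nonneg w).trans hr1.le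
  have key := hasDerivAt_tsum_of_isPreconnected (𝕜 := ℂ) (u := fun n : ℕ => r ^ n)
    (t := Metric.ball (0:ℂ) r) (g := fun n z => z ^ (n+1) / ((n+1 : ℕ) : ℂ) ^ (m+1))
    (g' := fun n z => z ^ n / ((n+1 : ℕ) : ℂ) ^ m) (y₀ := 0) (y := w)
    (summable_geometric_of_lt_one hr0 hr2) Metric.isOpen_ball
    (convex_ball _ _).isPreconnected ?_ ?_ ?_ ?_ ?_
  · have e : Li m w / w = ∑' n : ℕ, w ^ n / ((n+1 : ℕ) : ℂ) ^ m := by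
      rw [Li_eq_tsum m hw, ← tsum_div_const]
      refine tsum_congr fun n => ?_
      rw [pow_succ]
      field_simp
    rw [e]
    refine key.congr_of_eventuallyEq ?_
    filter_upwards [Metric.isOpen_ball.mem_nhds (show w ∈ Metric.ball (0:ℂ) 1 by simpa using hw)] with z hz
    exact Li_eq_tsum (m+1) (by simpa using hz)
  · intro n y _
    refine ((hasDerivAt_pow (n+1) y).div_const (((n+1 : ℕ) : ℂ) ^ (m+1))).congr_deriv ?_
    have : ((n+1 : ℕ) : ℂ) ≠ 0 := by exact_mod_cast Nat.succ_ne_zero n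
    rw [pow_succ ((n+1 : ℕ) : ℂ) m]
    simp only [Nat.add_sub_cancel]
    field_simp
  · intro n y hy
    have hy' : ‖y‖ < r := by simpa using hy
    rw [norm_div, norm_pow, norm_pow]
    have h1 : (1:ℝ) ≤ ‖((n+1 : ℕ) : ℂ)‖ ^ m := by
      apply one_le_pow₀
      rw [Complex.norm_natCast]
      exact_mod_cast Nat.succ_le_succ (Nat.zero_le n)
    calc ‖y‖ ^ n / ‖((n+1 : ℕ) : ℂ)‖ ^ m ≤ ‖y‖ ^ n := div_le_self (by positivity) h1
      _ ≤ r ^ n := by gcongr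
  · simpa using (norm_nonneg w).trans_lt hr1
  · simp
  · simpa using hr1

theorem Li_term_bound (m n : ℕ) {w : ℂ} (hw : ‖w‖ ≤ 1) :
    ‖w ^ (n+1) / ((n+1 : ℕ) : ℂ) ^ (m+2)‖ ≤ ‖w‖ * (1 / ((n+1 : ℕ) : ℝ) ^ 2) := by
  rw [norm_div, norm_pow, norm_pow, Complex.norm_natCast, pow_succ' ‖w‖, mul_div_assoc]
  have h1 : (1:ℝ) ≤ ((n+1 : ℕ) : ℝ) := by exact_mod_cast Nat.succ_le_succ (Nat.zero_le n)
  have h2 : ((n+1 : ℕ) : ℝ) ^ 2 ≤ ((n+1 : ℕ) : ℝ) ^ (m+2) := pow_le_pow_right₀ h1 (by omega)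
  have h3 : ‖w‖ ^ n ≤ 1 := pow_le_one₀ (norm_nonneg _) hw
  gcongr

theorem summable_sq_aux : Summable (fun n : ℕ => 1 / ((n+1 : ℕ) : ℝ) ^ 2) :=
  (summable_nat_add_iff 1 (f := fun n : ℕ => 1 / (n : ℝ) ^ 2)).2
    (Real.summable_one_div_nat_pow.2 (by norm_num))

theorem Li_bound (m : ℕ) (δ : ℝ) (hδ : 0 < δ) :
    ∃ C : ℝ, 0 ≤ C ∧ ∀ w : ℂ, ‖w‖ ≤ 1 → δ ≤ ‖1 - w‖ → ‖Li m w‖ ≤ C * ‖w‖ := by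
  match m with
  | 0 =>
    refine ⟨1/δ, by positivity, fun w hw h => ?_⟩
    simp only [Li, norm_div]
    calc ‖w‖ / ‖1 - w‖ ≤ ‖w‖ / δ := by gcongr
      _ = 1/δ * ‖w‖ := by ring
  | 1 =>
    refine ⟨2 * (|Real.log δ| + Real.log 2 + Real.pi) + 3/2, ?_, fun w hw h => ?_⟩
    · have := Real.log_nonneg (show (1:ℝ) ≤ 2 by norm_num)
      have := Real.pi_pos
      positivity
    have hl2 := Real.log_nonneg (show (1:ℝ) ≤ 2 by norm_num)
    have hpi := Real.pi_pos
    have habs := abs_nonneg (Real.log δ)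
    simp only [Li, norm_neg]
    rcases le_total ‖w‖ (1/2) with h2 | h2
    · have := norm_log_one_add_half_le_self (z := -w) (by simpa using h2)
      rw [norm_neg, ← sub_eq_add_neg] at this
      refine this.trans ?_
      gcongr
      linarith
    · have hpos : 0 < ‖1 - w‖ := hδ.trans_le h
      have hle2 : ‖1 - w‖ ≤ 2 := (norm_sub_le _ _).trans (by simp; linarith)
      have h3 : ‖Complex.log (1 - w)‖ ≤ |Real.log δ| + Real.log 2 + Real.pi := by
        refine (Complex.norm_le_abs_re_add_abs_im _).trans ?_
        rw [Complex.log_re, Complex.log_im]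
        have := Complex.abs_arg_le_pi (1 - w)
        have a1 : Real.log δ ≤ Real.log ‖1 - w‖ := Real.log_le_log hδ h
        have a2 : Real.log ‖1 - w‖ ≤ Real.log 2 := Real.log_le_log hpos hle2
        have a3 : |Real.log ‖1 - w‖| ≤ |Real.log δ| + Real.log 2 := by
          rw [abs_le]
          constructor
          · have := neg_abs_le (Real.log δ)
            linarith
          · linarith
        linarith
      nlinarith
  | (m+2) =>
    refine ⟨∑' n : ℕ, 1 / ((n+1 : ℕ) : ℝ) ^ 2, tsum_nonneg fun n => by positivity, fun w hw h => ?_⟩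
    simp only [Li]
    rw [mul_comm, ← tsum_mul_left]
    exact tsum_of_norm_bounded (summable_sq_aux.mul_left _).hasSum (fun n => Li_term_bound m n hw)

theorem one_sub_slit {w : ℂ} (hw : ‖w‖ ≤ 1) (h1 : w ≠ 1) : 1 - w ∈ slitPlane := by
  rw [mem_slitPlane_iff]
  by_contra hcon
  push Not at hcon
  obtain ⟨h2, h3⟩ := hcon
  simp at h2 h3
  have := Complex.re_le_norm w
  apply h1
  apply Complex.ext
  · simp; linarith
  · simpa using h3

theorem Li_continuousOn (m : ℕ) : ContinuousOn (Li m) (Metric.closedBall 0 1 \ {1}) := by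
  match m with
  | 0 =>
    have : Li 0 = fun z => z / (1 - z) := by ext; simp [Li]
    rw [this]
    refine ContinuousOn.div (by fun_prop) (by fun_prop) ?_
    rintro z ⟨_, hz⟩ h
    exact hz (by simpa using (sub_eq_zero.1 h).symm)
  | 1 =>
    have : Li 1 = fun z => -Complex.log (1 - z) := by ext; simp [Li]
    rw [this]
    refine ContinuousOn.neg (ContinuousOn.clog (by fun_prop) ?_)
    rintro z ⟨h, hz⟩
    exact one_sub_slit (by simpa using h) (by simpa using hz)
  | (m+2) =>
    have : Li (m+2) = fun z => ∑' n : ℕ, z ^ (n+1) / ((n+1 : ℕ) : ℂ) ^ (m+2) := by ext; simp [Li]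
    rw [this]
    refine continuousOn_tsum (fun n => by fun_prop) summable_sq_aux ?_
    rintro n z ⟨h, hz⟩
    have hz1 : ‖z‖ ≤ 1 := by simpa using h
    refine (Li_term_bound m n hz1).trans ?_
    refine mul_le_of_le_one_left (by positivity) hz1

theorem e2pi_norm (θ : ℝ) : ‖e2pi θ‖ = 1 := by
  have : e2pi θ = Complex.exp (((2 * Real.pi * θ : ℝ) : ℂ) * I) := by
    unfold e2pi; congr 1; push_cast; ring
  rw [this, Complex.norm_exp_ofReal_mul_I]

theorem e2pi_ne_one {θ : ℝ} (h : ∀ n : ℤ, θ ≠ n) : e2pi θ ≠ 1 := by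
  unfold e2pi
  rw [Ne, Complex.exp_eq_one_iff]
  rintro ⟨n, hn⟩
  apply h n
  have h2 : (2 * Real.pi * I : ℂ) ≠ 0 := Complex.two_pi_I_ne_zero
  have h3 : (2 * Real.pi * I : ℂ) * θ = (2 * Real.pi * I : ℂ) * n := by rw [hn]; ring
  have := mul_left_cancel₀ h2 h3
  exact_mod_cast this

/-- sector estimate -/
theorem sector_lower {b : ℂ} (hb : ‖b‖ = 1) (hb1 : b ≠ 1) (M : ℝ) (hM : 0 < M) :
    ∃ δ : ℝ, 0 < δ ∧ ∀ z : ℂ, 0 < z.re → ‖z‖ ≤ M * z.re → δ ≤ ‖1 - Complex.exp (-z) * b‖ := by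
  have hd : 0 < ‖1 - b‖ := by
    rw [norm_pos_iff, sub_ne_zero]; exact hb1.symm
  have hc : Tendsto (fun z : ℂ => ‖1 - Complex.exp (-z) * b‖) (𝓝 0) (𝓝 ‖1 - b‖) := by
    have : Continuous (fun z : ℂ => ‖1 - Complex.exp (-z) * b‖) := by fun_prop
    simpa using this.tendsto 0
  have := hc.eventually (lt_mem_nhds (half_lt_self hd))
  obtain ⟨ε, hε, hb'⟩ := Metric.eventually_nhds_iff.1 this
  have hη : 0 < ε / M := by positivity
  refine ⟨min (‖1 - b‖ / 2) (1 - Real.exp (-(ε / M))), ?_, fun z hz hzM => ?_⟩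
  · refine lt_min (by positivity) ?_
    have : Real.exp (-(ε / M)) < 1 := by rw [Real.exp_lt_one_iff]; linarith
    linarith
  · rcases lt_or_ge z.re (ε / M) with h | h
    · refine (min_le_left _ _).trans (hb' ?_).le
      rw [dist_zero_right]
      refine hzM.trans_lt ?_
      rw [lt_div_iff₀ hM] at h
      linarith
    · refine (min_le_right _ _).trans ?_
      have h1 : ‖Complex.exp (-z) * b‖ ≤ Real.exp (-(ε / M)) := by
        rw [norm_mul, hb, mul_one, Complex.norm_exp]
        simpa using h
      have h2 := norm_sub_norm_le (1:ℂ) (Complex.exp (-z) * b)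
      rw [norm_one] at h2
      linarith

theorem norm_exp_neg_mul {b : ℂ} (hb : ‖b‖ = 1) (z : ℂ) :
    ‖Complex.exp (-z) * b‖ = Real.exp (-z.re) := by
  rw [norm_mul, hb, mul_one, Complex.norm_exp]; simp

theorem norm_exp_neg_mul_lt {b : ℂ} (hb : ‖b‖ = 1) {z : ℂ} (hz : 0 < z.re) :
    ‖Complex.exp (-z) * b‖ < 1 := by
  rw [norm_exp_neg_mul hb, Real.exp_lt_one_iff]; linarith

theorem sector_bound {b : ℂ} (hb : ‖b‖ = 1) (hb1 : b ≠ 1) (m : ℕ) (M : ℝ) (hM : 0 < M) :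
    ∃ C : ℝ, 0 ≤ C ∧ ∀ z : ℂ, 0 < z.re → ‖z‖ ≤ M * z.re →
      ‖Li m (Complex.exp (-z) * b)‖ ≤ C * Real.exp (-z.re) := by
  obtain ⟨δ, hδ, h⟩ := sector_lower hb hb1 M hM
  obtain ⟨C, hC, h'⟩ := Li_bound m δ hδ
  refine ⟨C, hC, fun z hz hzM => ?_⟩
  have := h' _ (norm_exp_neg_mul_lt hb hz).le (h z hz hzM)
  rwa [norm_exp_neg_mul hb] at this

theorem LiE_hasDerivAt {b : ℂ} (hb : ‖b‖ = 1) (m : ℕ) {z : ℂ} (hz : 0 < z.re) :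
    HasDerivAt (fun z => Li (m+1) (Complex.exp (-z) * b)) (-Li m (Complex.exp (-z) * b)) z := by
  have hb0 : b ≠ 0 := by rintro rfl; simp at hb
  have hne : Complex.exp (-z) * b ≠ 0 := mul_ne_zero (Complex.exp_ne_zero _) hb0
  have h1 := Li_hasDerivAt m (norm_exp_neg_mul_lt hb hz) hne
  have h2 : HasDerivAt (fun z : ℂ => Complex.exp (-z) * b) (-(Complex.exp (-z) * b)) z := by
    refine (((hasDerivAt_neg z).cexp).mul_const b).congr_deriv ?_
    ring
  refine (h1.comp z h2).congr_deriv ?_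
  rw [mul_neg, div_mul_cancel₀ _ hne]

theorem LiE_differentiableAt {b : ℂ} (hb : ‖b‖ = 1) (m : ℕ) {z : ℂ} (hz : 0 < z.re) :
    DifferentiableAt ℂ (fun z => Li m (Complex.exp (-z) * b)) z := by
  match m with
  | 0 =>
    simp only [Li]
    refine DifferentiableAt.div (by fun_prop) (by fun_prop) ?_
    intro h
    have := norm_exp_neg_mul_lt hb hz
    rw [← sub_eq_zero.1 h] at this
    simp at this
  | (m+1) => exact (LiE_hasDerivAt hb m hz).differentiableAt

theorem integrableOn_of_exp_bound {f : ℝ → ℂ} {C c : ℝ} (hc : 0 < c)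
    (hf : ContinuousOn f (Ioi 0)) (hb : ∀ t : ℝ, 0 < t → ‖f t‖ ≤ C * Real.exp (-c * t)) :
    IntegrableOn f (Ioi 0) := by
  refine Integrable.mono' ((exp_neg_integrableOn_Ioi 0 hc).const_mul C)
    (hf.aestronglyMeasurable measurableSet_Ioi) ?_
  filter_upwards [ae_restrict_mem measurableSet_Ioi] with t ht using hb t ht

theorem ray_rotation {U : Set ℂ} (hU : IsOpen U) (hUc : IsPreconnected U)
    (hcone : ∀ t : ℝ, 0 < t → ∀ z ∈ U, z * t ∈ U) {H : ℂ → ℂ} (hH : DifferentiableOn ℂ H U)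
    (hbd : ∀ w₀ ∈ U, ∃ r > 0, ∃ C c : ℝ, 0 < c ∧ 0 ≤ C ∧ Metric.ball w₀ r ⊆ U ∧
      ∀ w ∈ Metric.ball w₀ r, ∀ t : ℝ, 0 < t → ‖H (w * t)‖ ≤ C * Real.exp (-c * t))
    {w₁ w₂ : ℂ} (h₁ : w₁ ∈ U) (h₂ : w₂ ∈ U) :
    ∫ t in Ioi (0:ℝ), w₁ * H (w₁ * t) = ∫ t in Ioi (0:ℝ), w₂ * H (w₂ * t) := by
  have hcont : ∀ w ∈ U, ContinuousOn (fun t : ℝ => H (w * t)) (Ioi 0) := by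
    intro w hw
    refine hH.continuousOn.comp (by fun_prop) ?_
    intro t ht
    exact hcone t ht w hw
  have hdcont : ∀ w ∈ U, ContinuousOn (fun t : ℝ => deriv H (w * t)) (Ioi 0) := by
    intro w hw
    refine (hH.deriv hU).continuousOn.comp (by fun_prop) ?_
    intro t ht
    exact hcone t ht w hw
  have hHd : ∀ w ∈ U, ∀ t : ℝ, 0 < t → HasDerivAt H (deriv H (w * t)) (w * t) := by
    intro w hw t ht
    exact (hH.differentiableAt (hU.mem_nhds (hcone t ht w hw))).hasDerivAt
  have hFd : ∀ w ∈ U, ∀ t : ℝ, 0 < t →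
      HasDerivAt (fun w : ℂ => w * H (w * t)) (H (w * t) + w * (deriv H (w * t) * t)) w := by
    intro w hw t ht
    have h1 : HasDerivAt (fun w : ℂ => w * (t:ℂ)) (t:ℂ) w := by
      simpa using (hasDerivAt_id w).mul_const (t:ℂ)
    refine ((hasDerivAt_id w).mul ((hHd w hw t ht).comp w h1)).congr_deriv ?_
    simp
  have key : ∀ w₀ ∈ U, HasDerivAt (fun w : ℂ => ∫ t in Ioi (0:ℝ), w * H (w * t)) 0 w₀ := by
    intro w₀ hw₀
    obtain ⟨r, hr, C, c, hc, hC, hsub, hb⟩ := hbd w₀ hw₀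
    have hFb : ∀ w ∈ Metric.ball w₀ r, ∀ t : ℝ, 0 < t →
        ‖w * H (w * t)‖ ≤ (‖w₀‖ + r) * (C * Real.exp (-c * t)) := by
      intro w hw t ht
      rw [norm_mul]
      have h1 : ‖w‖ ≤ ‖w₀‖ + r := by
        have := norm_add_le w₀ (w - w₀)
        rw [add_sub_cancel] at this
        rw [Metric.mem_ball, dist_eq_norm] at hw
        linarith
      exact mul_le_mul h1 (hb w hw t ht) (norm_nonneg _) (by positivity)
    have hF'b : ∀ w ∈ Metric.ball w₀ (r/2), ∀ t : ℝ, 0 < t →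
        ‖H (w * t) + w * (deriv H (w * t) * t)‖ ≤
          ((‖w₀‖ + r) * C / (r/4)) * Real.exp (-c * t) := by
      intro w hw t ht
      rw [Metric.mem_ball] at hw
      have hcl : Metric.closedBall w (r/4) ⊆ Metric.ball w₀ r := by
        intro y hy
        rw [Metric.mem_closedBall] at hy
        rw [Metric.mem_ball]
        have := dist_triangle y w w₀
        linarith
      have hwU : w ∈ U := hsub (hcl (Metric.mem_closedBall_self (by positivity)))
      rw [← (hFd w hwU t ht).deriv]
      have := Complex.norm_deriv_le_of_forall_mem_sphere_norm_le (c := w) (R := r/4)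
        (f := fun w : ℂ => w * H (w * t)) (C := (‖w₀‖ + r) * (C * Real.exp (-c * t)))
        (by positivity) ?_ ?_
      · refine this.trans (le_of_eq ?_)
        ring
      · refine DifferentiableOn.diffContOnCl ?_
        rw [closure_ball _ (by positivity)]
        intro y hy
        exact (hFd y (hsub (hcl hy)) t ht).differentiableAt.differentiableWithinAt
      · intro z hz
        exact hFb z (hcl (Metric.sphere_subset_closedBall hz)) t ht
    have hF'cont : ContinuousOn (fun t : ℝ => H (w₀ * t) + w₀ * (deriv H (w₀ * t) * t)) (Ioi 0) := by
      refine (hcont w₀ hw₀).add (continuousOn_const.mul ((hdcont w₀ hw₀).mul ?_))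
      exact Complex.continuous_ofReal.continuousOn
    have main := hasDerivAt_integral_of_dominated_loc_of_deriv_le (𝕜 := ℂ)
      (μ := volume.restrict (Ioi (0:ℝ))) (x₀ := w₀) (s := Metric.ball w₀ (r/2))
      (F := fun w t => w * H (w * t)) (F' := fun w t => H (w * t) + w * (deriv H (w * t) * t))
      (bound := fun t => ((‖w₀‖ + r) * C / (r/4)) * Real.exp (-c * t))
      (Metric.ball_mem_nhds _ (by positivity)) ?_ ?_ ?_ ?_ ?_ ?_
    · obtain ⟨hint, hder⟩ := main
      refine hder.congr_deriv ?_
      have := integral_Ioi_of_hasDerivAt_of_tendsto (a := 0) (m := 0)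
        (f := fun t : ℝ => (t:ℂ) * H (w₀ * t))
        (f' := fun t : ℝ => H (w₀ * t) + w₀ * (deriv H (w₀ * t) * t)) ?_ ?_ hint ?_
      · rw [this]; simp
      · have hz : ((0:ℝ):ℂ) * H (w₀ * (0:ℝ)) = 0 := by simp
        unfold ContinuousWithinAt
        beta_reduce
        rw [hz]
        rw [tendsto_zero_iff_norm_tendsto_zero]
        refine squeeze_zero' (g := fun t : ℝ => t * C) (Eventually.of_forall fun _ => norm_nonneg _) ?_ ?_
        · filter_upwards [self_mem_nhdsWithin] with t ht
          rcases (mem_Ici.1 ht).eq_or_lt with h | h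
          · rw [← h]; simp
          · rw [norm_mul, Complex.norm_real, Real.norm_of_nonneg h.le]
            refine mul_le_mul_of_nonneg_left ?_ h.le
            refine (hb w₀ (Metric.mem_ball_self hr) t h).trans ?_
            refine mul_le_of_le_one_right hC ?_
            rw [Real.exp_le_one_iff]
            nlinarith
        · have : Continuous (fun t : ℝ => t * C) := by fun_prop
          simpa using (this.tendsto 0).mono_left nhdsWithin_le_nhds
      · intro t ht
        have h1 : HasDerivAt (fun t : ℝ => w₀ * (t:ℂ)) w₀ t := by
          simpa using (hasDerivAt_id t).ofReal_comp.const_mul w₀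
        have h2 := (hHd w₀ hw₀ t ht).comp t h1
        have h3 : HasDerivAt (fun t : ℝ => (t:ℂ)) 1 t := by
          simpa using (hasDerivAt_id t).ofReal_comp
        refine (h3.mul h2).congr_deriv ?_
        simp only [Function.comp]
        ring
      · rw [tendsto_zero_iff_norm_tendsto_zero]
        refine squeeze_zero' (g := fun t : ℝ => C * (t ^ (1:ℝ) * Real.exp (-c * t)))
          (Eventually.of_forall fun _ => norm_nonneg _) ?_ ?_
        · filter_upwards [eventually_gt_atTop 0] with t h
          rw [norm_mul, Complex.norm_real, Real.norm_of_nonneg h.le, Real.rpow_one]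
          have := mul_le_mul_of_nonneg_left (hb w₀ (Metric.mem_ball_self hr) t h) h.le
          linarith
        · simpa using (tendsto_rpow_mul_exp_neg_mul_atTop_nhds_zero 1 c hc).const_mul C
    · filter_upwards [hU.mem_nhds hw₀] with w hw
      exact (continuousOn_const.mul (hcont w hw)).aestronglyMeasurable measurableSet_Ioi
    · refine integrableOn_of_exp_bound (C := (‖w₀‖ + r) * C) hc (continuousOn_const.mul (hcont w₀ hw₀)) ?_
      intro t ht
      rw [mul_assoc (‖w₀‖ + r)]
      exact hFb w₀ (Metric.mem_ball_self hr) t ht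
    · exact hF'cont.aestronglyMeasurable measurableSet_Ioi
    · filter_upwards [ae_restrict_mem measurableSet_Ioi] with t ht w hw using hF'b w hw t ht
    · exact (exp_neg_integrableOn_Ioi 0 hc).const_mul _
    · filter_upwards [ae_restrict_mem measurableSet_Ioi] with t ht w hw
      exact hFd w (hsub (Metric.ball_subset_ball (by linarith) hw)) t ht
  exact hU.is_const_of_deriv_eq_zero hUc (f := fun w : ℂ => ∫ t in Ioi (0:ℝ), w * H (w * t))
    (fun w hw => (key w hw).differentiableAt.differentiableWithinAt)
    (fun w hw => (key w hw).deriv) h₁ h₂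

theorem ray_ne_one {a : ℂ} (ha : ‖a‖ = 1) {z : ℂ} (hz : 0 < z.re) : 1 - Complex.exp (-z) * a ≠ 0 := by
  intro h
  have := norm_exp_neg_mul_lt ha hz
  rw [← sub_eq_zero.1 h] at this
  simp at this

theorem re_mul_ofReal_pos {x : ℂ} (hx : 0 < x.re) {t : ℝ} (ht : 0 < t) : 0 < (x * t).re := by
  simpa using mul_pos hx ht

theorem ray_cont {a : ℂ} (ha : ‖a‖ = 1) (ha1 : a ≠ 1) (m : ℕ) {x : ℂ} (hx : 0 < x.re) :
    ContinuousOn (fun t : ℝ => Li m (Complex.exp (-(x * t)) * a)) (Ici 0) := by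
  refine (Li_continuousOn m).comp (by fun_prop) ?_
  intro t ht
  rcases (mem_Ici.1 ht).eq_or_lt with h | h
  · rw [← h]; simp [ha, ha1]
  · have := norm_exp_neg_mul_lt ha (re_mul_ofReal_pos hx h)
    refine ⟨by simpa using this.le, ?_⟩
    intro h'
    have h2 : Complex.exp (-(x * t)) * a = 1 := h'
    rw [h2] at this
    simp at this

theorem ray_bound {a : ℂ} (ha : ‖a‖ = 1) (ha1 : a ≠ 1) (m : ℕ) {x : ℂ} (hx : 0 < x.re) :
    ∃ C : ℝ, 0 ≤ C ∧ ∀ t : ℝ, 0 < t →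
      ‖Li m (Complex.exp (-(x * t)) * a)‖ ≤ C * Real.exp (-x.re * t) := by
  have hx0 : 0 < ‖x‖ := hx.trans_le (Complex.re_le_norm x)
  obtain ⟨C, hC, h⟩ := sector_bound ha ha1 m (‖x‖ / x.re) (by positivity)
  refine ⟨C, hC, fun t ht => ?_⟩
  have := h (x * t) (re_mul_ofReal_pos hx ht) ?_
  · simpa using this
  · rw [norm_mul, Complex.norm_real, Real.norm_of_nonneg ht.le]
    simp
    field_simp
    exact le_rfl

theorem ray_deriv {a : ℂ} (ha : ‖a‖ = 1) (m : ℕ) {x : ℂ} (hx : 0 < x.re) {t : ℝ} (ht : 0 < t) :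
    HasDerivAt (fun t : ℝ => Li (m+1) (Complex.exp (-(x * t)) * a))
      (-x * Li m (Complex.exp (-(x * t)) * a)) t := by
  have h1 : HasDerivAt (fun t : ℝ => x * (t:ℂ)) x t := by
    simpa using (hasDerivAt_id t).ofReal_comp.const_mul x
  refine ((LiE_hasDerivAt ha m (re_mul_ofReal_pos hx ht)).comp t h1).congr_deriv ?_
  ring

theorem ray_tendsto {a : ℂ} (ha : ‖a‖ = 1) (ha1 : a ≠ 1) (m : ℕ) {x : ℂ} (hx : 0 < x.re) :
    Tendsto (fun t : ℝ => Li m (Complex.exp (-(x * t)) * a)) atTop (𝓝 0) := by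
  obtain ⟨C, hC, h⟩ := ray_bound ha ha1 m hx
  rw [tendsto_zero_iff_norm_tendsto_zero]
  refine squeeze_zero' (g := fun t : ℝ => C * (t ^ (0:ℝ) * Real.exp (-x.re * t)))
    (Eventually.of_forall fun _ => norm_nonneg _) ?_ ?_
  · filter_upwards [eventually_gt_atTop 0] with t ht
    rw [Real.rpow_zero, one_mul]
    exact h t ht
  · simpa only [mul_zero] using (tendsto_rpow_mul_exp_neg_mul_atTop_nhds_zero 0 x.re hx).const_mul C

theorem ray_integrable {a : ℂ} (ha : ‖a‖ = 1) (ha1 : a ≠ 1) (m : ℕ) {x : ℂ} (hx : 0 < x.re) :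
    IntegrableOn (fun t : ℝ => Li m (Complex.exp (-(x * t)) * a)) (Ioi 0) := by
  obtain ⟨C, hC, h⟩ := ray_bound ha ha1 m hx
  exact integrableOn_of_exp_bound hx ((ray_cont ha ha1 m hx).mono Ioi_subset_Ici_self) h

theorem ray_integral {a : ℂ} (ha : ‖a‖ = 1) (ha1 : a ≠ 1) (m : ℕ) {x : ℂ} (hx : 0 < x.re) :
    ∫ t in Ioi (0:ℝ), Li m (Complex.exp (-(x * t)) * a) = x⁻¹ * Li (m+1) a := by
  have hx0 : x ≠ 0 := by rintro rfl; simp at hx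
  have := integral_Ioi_of_hasDerivAt_of_tendsto (a := 0) (m := 0)
    (f := fun t : ℝ => Li (m+1) (Complex.exp (-(x * t)) * a))
    (f' := fun t : ℝ => -x * Li m (Complex.exp (-(x * t)) * a))
    (ray_cont ha ha1 (m+1) hx 0 self_mem_Ici) (fun t ht => ray_deriv ha m hx ht)
    ((ray_integrable ha ha1 m hx).const_mul _) (ray_tendsto ha ha1 (m+1) hx)
  rw [integral_const_mul] at this
  simp at this
  field_simp
  exact this

theorem ray2_integrable {a b : ℂ} (ha : ‖a‖ = 1) (ha1 : a ≠ 1) (hb : ‖b‖ = 1) (hb1 : b ≠ 1)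
    (m n : ℕ) {x y : ℂ} (hx : 0 < x.re) (hy : 0 < y.re) :
    IntegrableOn (fun t : ℝ => Li m (Complex.exp (-(x * t)) * a) * Li n (Complex.exp (-(y * t)) * b))
      (Ioi 0) := by
  obtain ⟨C, hC, h⟩ := ray_bound ha ha1 m hx
  obtain ⟨C', hC', h'⟩ := ray_bound hb hb1 n hy
  refine integrableOn_of_exp_bound (C := C * C') (add_pos hx hy)
    (((ray_cont ha ha1 m hx).mul (ray_cont hb hb1 n hy)).mono Ioi_subset_Ici_self) ?_
  intro t ht
  rw [norm_mul]
  refine (mul_le_mul (h t ht) (h' t ht) (norm_nonneg _) (by positivity)).trans (le_of_eq ?_)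
  rw [show -(x.re + y.re) * t = -x.re * t + -y.re * t by ring, Real.exp_add]
  ring

def GG (x a b : ℂ) (m n : ℕ) : ℂ :=
  ∫ t in Ioi (0:ℝ), Li m (Complex.exp (-(x * t)) * a) * Li n (Complex.exp (-(1 * t)) * b)

theorem GG_rec {a b : ℂ} (ha : ‖a‖ = 1) (ha1 : a ≠ 1) (hb : ‖b‖ = 1) (hb1 : b ≠ 1)
    (m n : ℕ) {x : ℂ} (hx : 0 < x.re) :
    GG x a b (m+1) n = Li (m+1) a * Li (n+1) b + (-x) * GG x a b m (n+1) := by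
  have h1 : 0 < (1:ℂ).re := by simp
  have i1 := ray2_integrable ha ha1 hb hb1 (m+1) n hx h1
  have i2 := ray2_integrable ha ha1 hb hb1 m (n+1) hx h1
  have := integral_Ioi_of_hasDerivAt_of_tendsto (a := 0) (m := 0)
    (f := fun t : ℝ => Li (m+1) (Complex.exp (-(x * t)) * a) * Li (n+1) (Complex.exp (-(1 * t)) * b))
    (f' := fun t : ℝ => (-x) * (Li m (Complex.exp (-(x * t)) * a) * Li (n+1) (Complex.exp (-(1 * t)) * b))
      - Li (m+1) (Complex.exp (-(x * t)) * a) * Li n (Complex.exp (-(1 * t)) * b))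
    (((ray_cont ha ha1 (m+1) hx).mul (ray_cont hb hb1 (n+1) h1)) 0 self_mem_Ici)
    (fun t ht => ((ray_deriv ha m hx ht).mul (ray_deriv hb n h1 ht)).congr_deriv (by ring))
    ((i2.const_mul _).sub i1)
    (by simpa using (ray_tendsto ha ha1 (m+1) hx).mul (ray_tendsto hb hb1 (n+1) h1))
  rw [integral_sub (i2.const_mul _) i1, integral_const_mul] at this
  simp only [Complex.ofReal_zero, mul_zero, neg_zero, Complex.exp_zero, one_mul, zero_sub] at this
  unfold GG
  simp only [one_mul] at this ⊢
  linear_combination -this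

theorem GG_sum {a b : ℂ} (ha : ‖a‖ = 1) (ha1 : a ≠ 1) (hb : ‖b‖ = 1) (hb1 : b ≠ 1)
    {x : ℂ} (hx : 0 < x.re) (m n : ℕ) :
    GG x a b m n = ∑ r ∈ Finset.range m, (-x) ^ r * Li (m - r) a * Li (n + r + 1) b
      + (-x) ^ m * GG x a b 0 (n + m) := by
  induction m generalizing n with
  | zero => simp
  | succ m ih =>
    rw [GG_rec ha ha1 hb hb1 m n hx, ih (n+1), Finset.sum_range_succ', mul_add, Finset.mul_sum]
    have : ∀ r ∈ Finset.range m, -x * ((-x) ^ r * Li (m - r) a * Li (n + 1 + r + 1) b) =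
        (-x) ^ (r+1) * Li (m + 1 - (r + 1)) a * Li (n + (r + 1) + 1) b := by
      intro r _
      rw [show m + 1 - (r+1) = m - r by omega, show n + 1 + r + 1 = n + (r + 1) + 1 by omega]
      ring
    rw [Finset.sum_congr rfl this, show n + 1 + m = n + (m + 1) by omega]
    simp
    ring

theorem div_eq_add {w L : ℂ} (hw : 1 - w ≠ 0) : L / (1 - w) = L + L * Li 0 w := by
  simp only [Li]
  field_simp
  ring

theorem HHZN_first {k : ℕ} {α β : ℝ}
    (hα : ∀ n : ℤ, α ≠ n) (hβ : ∀ n : ℤ, β ≠ n) {x : ℂ} (hx : 0 < x.re) :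
    HHZN (k+1) x α β = x⁻¹ * Li (k+1) (e2pi α) + GG x (e2pi α) (e2pi β) k 0 := by
  have h1 : 0 < (1:ℂ).re := by simp
  unfold HHZN GG
  rw [← ray_integral (e2pi_norm α) (e2pi_ne_one hα) k hx,
    ← integral_add (ray_integrable (e2pi_norm α) (e2pi_ne_one hα) k hx)
      (ray2_integrable (e2pi_norm α) (e2pi_ne_one hα) (e2pi_norm β) (e2pi_ne_one hβ) k 0 hx h1)]
  refine setIntegral_congr_fun measurableSet_Ioi fun t ht => ?_
  simp only [one_mul, neg_mul, Nat.add_sub_cancel]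
  exact div_eq_add (ray_ne_one (e2pi_norm β) (by simpa using ht))

theorem HHZN_second {k : ℕ} {α β : ℝ}
    (hα : ∀ n : ℤ, α ≠ n) (hβ : ∀ n : ℤ, β ≠ n) {x : ℂ} (hx : 0 < x.re) :
    HHZN (k+1) x⁻¹ β α = x * (Li (k+1) (e2pi β) + GG x (e2pi α) (e2pi β) 0 k) := by
  have hx0 : x ≠ 0 := by rintro rfl; simp at hx
  have h1 : 0 < (1:ℂ).re := by simp
  have ha := e2pi_norm α
  have ha1 := e2pi_ne_one hα
  have hb := e2pi_norm β
  have hb1 := e2pi_ne_one hβ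
  set a := e2pi α
  set b := e2pi β
  let U : Set ℂ := {z | 0 < z.re} ∩ {z | 0 < (x * z).re}
  have hUo : IsOpen U := by
    refine IsOpen.inter (isOpen_lt continuous_const Complex.continuous_re)
      (isOpen_lt continuous_const (Complex.continuous_re.comp (by fun_prop)))
  have hUc : Convex ℝ U := by
    intro z hz w hw s t hs ht hst
    obtain ⟨hz1, hz2⟩ := hz
    obtain ⟨hw1, hw2⟩ := hw
    simp only [mem_ofPred_eq] at hz1 hz2 hw1 hw2
    have aux : ∀ p q : ℝ, 0 < p → 0 < q → 0 < s * p + t * q := by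
      intro p q hp hq
      rcases hs.eq_or_lt with h | h
      · have : t = 1 := by linarith
        rw [← h, this]; linarith
      · have := mul_pos h hp
        have := mul_nonneg ht hq.le
        linarith
    constructor
    · have := aux _ _ hz1 hw1
      simpa using this
    · have := aux _ _ hz2 hw2
      simp only [mem_ofPred_eq, mul_add, mul_smul_comm, Complex.add_re, Complex.smul_re, smul_eq_mul]
      exact this
  let H : ℂ → ℂ := fun z => Li k (Complex.exp (-z) * b) / (1 - Complex.exp (-(x * z)) * a)
  have rot := ray_rotation (U := U) hUo hUc.isPreconnected (H := H) (w₁ := x⁻¹) (w₂ := 1) ?_ ?_ ?_ ?_ ?_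
  · have e1 : ∫ t in Ioi (0:ℝ), x⁻¹ * H (x⁻¹ * t) = x⁻¹ * HHZN (k+1) x⁻¹ β α := by
      rw [integral_const_mul]
      unfold HHZN
      congr 1
      refine setIntegral_congr_fun measurableSet_Ioi fun t ht => ?_
      simp only [H, Nat.add_sub_cancel, mul_inv_cancel_left₀ hx0, neg_mul]
      rfl
    have e2 : ∫ t in Ioi (0:ℝ), 1 * H (1 * t) = Li (k+1) b + GG x a b 0 k := by
      unfold GG
      have := ray_integral hb hb1 k h1
      rw [inv_one, one_mul] at this
      rw [← this, ← integral_add (ray_integrable hb hb1 k h1)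
        (ray2_integrable ha ha1 hb hb1 0 k hx h1)]
      refine setIntegral_congr_fun measurableSet_Ioi fun t ht => ?_
      simp only [H, one_mul]
      rw [div_eq_add (ray_ne_one ha (re_mul_ofReal_pos hx ht))]
      ring
    rw [e1, e2] at rot
    rw [← rot, mul_inv_cancel_left₀ hx0]
  · intro t ht z hz
    refine ⟨re_mul_ofReal_pos hz.1 ht, ?_⟩
    have := re_mul_ofReal_pos hz.2 ht
    rwa [mul_assoc] at this
  · intro z hz
    refine DifferentiableAt.differentiableWithinAt ?_
    refine (LiE_differentiableAt hb k hz.1).div (by fun_prop) (ray_ne_one ha hz.2)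
  · intro w₀ hw₀
    have p1 : 0 < w₀.re := hw₀.1
    have p2 : 0 < (x * w₀).re := hw₀.2
    let V : Set ℂ := {z | w₀.re / 2 < z.re} ∩ {z | (x * w₀).re / 2 < (x * z).re} ∩ {z | ‖z‖ < ‖w₀‖ + 1}
    have hV : V ∈ 𝓝 w₀ := by
      refine IsOpen.mem_nhds ?_ ⟨⟨half_lt_self p1, half_lt_self p2⟩, by simp⟩
      exact ((isOpen_lt continuous_const Complex.continuous_re).inter
        (isOpen_lt continuous_const (Complex.continuous_re.comp (by fun_prop)))).inter
        (isOpen_lt continuous_norm continuous_const)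
    obtain ⟨r, hr, hrV⟩ := Metric.mem_nhds_iff.1 hV
    obtain ⟨C, hC, hCb⟩ := sector_bound hb hb1 k ((‖w₀‖ + 1) / (w₀.re / 2)) (by positivity)
    have hx0' : 0 < ‖x‖ := norm_pos_iff.2 hx0
    obtain ⟨δ, hδ, hδb⟩ := sector_lower ha ha1 (‖x‖ * (‖w₀‖ + 1) / ((x * w₀).re / 2)) (by positivity)
    refine ⟨r, hr, C / δ, w₀.re / 2, by positivity, by positivity, ?_, ?_⟩
    · intro z hz
      obtain ⟨⟨q1, q2⟩, _⟩ := hrV hz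
      exact ⟨(half_pos p1).trans q1, (half_pos p2).trans q2⟩
    · intro w hw t ht
      obtain ⟨⟨q1, q2⟩, q3⟩ := hrV hw
      simp only [mem_ofPred_eq] at q1 q2 q3
      have r1 : 0 < w.re := (half_pos p1).trans q1
      have r2 : 0 < (x * w).re := (half_pos p2).trans q2
      have s1 := hCb (w * t) (re_mul_ofReal_pos r1 ht) ?_
      have s2 := hδb (x * w * t) (re_mul_ofReal_pos r2 ht) ?_
      · simp only [H]
        rw [norm_div, ← mul_assoc x]
        have s3 : Real.exp (-(w * t).re) ≤ Real.exp (-(w₀.re / 2) * t) := by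
          rw [Real.exp_le_exp, Complex.re_mul_ofReal]
          nlinarith
        calc _ ≤ (C * Real.exp (-(w₀.re / 2) * t)) / δ := by
              refine div_le_div₀ (by positivity) (s1.trans ?_) hδ s2
              exact mul_le_mul_of_nonneg_left s3 hC
          _ = _ := by ring
      · rw [norm_mul, norm_mul, Complex.norm_real, Real.norm_of_nonneg ht.le, Complex.re_mul_ofReal,
          ← mul_assoc]
        refine mul_le_mul_of_nonneg_right ?_ ht.le
        rw [div_mul_eq_mul_div, le_div_iff₀ (by positivity)]
        refine mul_le_mul (mul_le_mul_of_nonneg_left q3.le hx0'.le) q2.le (by positivity) (by positivity)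
      · rw [norm_mul, Complex.norm_real, Real.norm_of_nonneg ht.le, Complex.re_mul_ofReal,
          ← mul_assoc]
        refine mul_le_mul_of_nonneg_right ?_ ht.le
        rw [div_mul_eq_mul_div, le_div_iff₀ (by positivity)]
        exact mul_le_mul q3.le q1.le (by positivity) (by positivity)
  · refine ⟨?_, by rw [mem_ofPred_eq, mul_inv_cancel₀ hx0]; exact h1⟩
    simp only [mem_ofPred_eq, Complex.inv_re]
    exact div_pos hx (Complex.normSq_pos.2 hx0)
  · exact ⟨by simp, by simpa using hx⟩

/-- The two-term functional equation for the higher Herglotz–Zagier–Novikov function: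
`𝓕_k(x; α, β) + (-x)^{k-2} 𝓕_k(1/x; β, α) = (1/x) Li_k(e^{2πiα}) - (-x)^{k-1} Li_k(e^{2πiβ})
  + ∑_{r=1}^{k-1} (-x)^{r-1} Li_{k-r}(e^{2πiα}) Li_r(e^{2πiβ})`. -/
theorem HHZN_two_term_functional_equation (k : ℕ) (hk : 1 ≤ k) (α β : ℝ)
    (hα : ∀ n : ℤ, α ≠ n) (hβ : ∀ n : ℤ, β ≠ n) (x : ℂ) (hx : 0 < x.re) :
    HHZN k x α β + (-x) ^ ((k : ℤ) - 2) * HHZN k x⁻¹ β α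
      = x⁻¹ * Li k (e2pi α) - (-x) ^ (k - 1) * Li k (e2pi β) +
        ∑ r ∈ Finset.Icc 1 (k - 1),
          (-x) ^ (r - 1) * Li (k - r) (e2pi α) * Li r (e2pi β) := by
  obtain ⟨k, rfl⟩ : ∃ j, k = j + 1 := ⟨k - 1, by omega⟩
  have hx0 : x ≠ 0 := by rintro rfl; simp at hx
  rw [HHZN_first hα hβ hx, HHZN_second hα hβ hx,
    GG_sum (e2pi_norm α) (e2pi_ne_one hα) (e2pi_norm β) (e2pi_ne_one hβ) hx k 0]
  have hz : (-x) ^ (((k + 1 : ℕ) : ℤ) - 2) * x = -(-x) ^ k := by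
    have h1 : (((k + 1 : ℕ) : ℤ) - 2) = (k : ℤ) - 1 := by push_cast; ring
    rw [h1, zpow_sub_one₀ (neg_ne_zero.2 hx0), zpow_natCast, inv_neg]
    field_simp
  have hs : ∑ r ∈ Finset.Icc 1 (k + 1 - 1),
      (-x) ^ (r - 1) * Li (k + 1 - r) (e2pi α) * Li r (e2pi β) =
      ∑ r ∈ Finset.range k, (-x) ^ r * Li (k - r) (e2pi α) * Li (0 + r + 1) (e2pi β) := by
    rw [Nat.add_sub_cancel, Finset.range_eq_Ico, ← Finset.Ico_add_one_right_eq_Icc,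
      Finset.sum_Ico_eq_sum_range, ← Finset.range_eq_Ico]
    refine Finset.sum_congr (by simp) fun r _ => ?_
    rw [show 1 + r - 1 = r by omega, show k + 1 - (1 + r) = k - r by omega,
      show 1 + r = 0 + r + 1 by omega]
  rw [hs, ← mul_assoc, hz, Nat.add_sub_cancel, zero_add]
  ring

end
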